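/- arXiv:1203.6795 — 2 statements merged into one kernel-verified Lean document; each statement's English description precedes it below -/
import Mathlib

section
/- Every subshift X ⊆ 𝟚^ℤ that is closed under the cellwise operations ⊓ and ⊔ is a shift of finite type. -/
/-- The shift map on the full shift `ℤ → α`. -/
def shiftMap {α : Type*} (x : ℤ → α) : ℤ → α := fun i => x (i + 1)

/-- `X` is a subshift: shift-invariant (`σ(X) = X`) and closed. -/
def IsSubshift {α : Type*} (X : Set (ℤ → α)) : Prop :=
  (∀ x ∈ X, shiftMap x ∈ X) ∧ (∀ x ∈ X, ∃ y ∈ X, shiftMap y = x) ∧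
    ∀ x : ℤ → α, (∀ n : ℕ, ∃ y ∈ X, ∀ i : ℤ, |i| ≤ (n : ℤ) → y i = x i) → x ∈ X

/-- `X` is a shift of finite type: it is defined by a set `W` of allowed words of
some length `n ≥ 1`. -/
def IsSFT {α : Type*} (X : Set (ℤ → α)) : Prop :=
  ∃ n : ℕ, 0 < n ∧ ∃ W : Set (Fin n → α),
    X = {x : ℤ → α | ∀ i : ℤ, (fun k : Fin n => x (i + (k : ℕ))) ∈ W}

/-- Membership in a set of naturals is reached from `0` by adding boundedly large elements of it. -/
theorem exists_bound_forall_of_add (P : ℕ → Prop) :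
    ∃ N : ℕ, ∀ Q : ℕ → Prop, Q 0 → (∀ a b, Q a → P b → b ≤ N → Q (a + b)) →
      ∀ d, P d → Q d := by
  classical
  by_cases h : ∃ m, 0 < m ∧ P m
  · obtain ⟨m, hm, hPm⟩ := h
    have key : ∀ r, ∃ a, ∀ d, P d → d % m = r → P a ∧ a % m = r ∧ a ≤ d := by
      intro r
      by_cases hr : ∃ d, P d ∧ d % m = r
      · exact ⟨Nat.find hr, fun d hd hdr =>
          ⟨(Nat.find_spec hr).1, (Nat.find_spec hr).2, Nat.find_min' hr ⟨hd, hdr⟩⟩⟩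
      · exact ⟨0, fun d hd hdr => absurd ⟨d, hd, hdr⟩ hr⟩
    choose f hf using key
    refine ⟨m + (Finset.range m).sup f, fun Q h0 hadd d hd => ?_⟩
    obtain ⟨hPf, hmod, hle⟩ := hf (d % m) d hd rfl
    have hfle : f (d % m) ≤ (Finset.range m).sup f :=
      Finset.le_sup (Finset.mem_range.2 (Nat.mod_lt d hm))
    have hQ : ∀ k, Q (f (d % m) + m * k) := by
      intro k
      induction k with
      | zero => simpa using hadd 0 _ h0 hPf (by omega)
      | succ k ih => simpa [Nat.mul_succ, add_assoc] using hadd _ m ih hPm (by omega)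
    obtain ⟨k, hk⟩ : m ∣ d - f (d % m) := (Nat.modEq_iff_dvd' hle).1 hmod
    have hQk := hQ k
    rwa [← hk, Nat.add_sub_cancel' hle] at hQk
  · refine ⟨0, fun Q h0 _ d hd => ?_⟩
    obtain rfl : d = 0 := by
      by_contra hne
      exact h ⟨d, Nat.pos_of_ne_zero hne, hd⟩
    exact h0

theorem IsSubshift.translate_mem {α : Type*} {X : Set (ℤ → α)} (hX : IsSubshift X)
    {x : ℤ → α} (hx : x ∈ X) (k : ℤ) : (fun i => x (i + k)) ∈ X := by
  induction k using Int.induction_on with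
  | zero => simpa using hx
  | succ k ih =>
    convert hX.1 _ ih using 1
    funext i
    simp only [shiftMap]
    congr 1
    ring
  | pred k ih =>
    obtain ⟨y, hy, hyx⟩ := hX.2.1 _ ih
    convert hy using 1
    funext i
    have h := congrFun hyx (i - 1)
    simp only [shiftMap, sub_add_cancel] at h
    rw [h]
    congr 1
    ring

/-- A sublattice of `𝟚^ι` interpolates on finite sets every point that it interpolates on pairs. -/
theorem exists_mem_eq_on_of_pairwise {ι : Type*} {X : Set (ι → Bool)}
    (hops : ∀ x ∈ X, ∀ y ∈ X, (fun i => x i && y i) ∈ X ∧ (fun i => x i || y i) ∈ X)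
    (hne : X.Nonempty) {I J : Finset ι}
    (hI : ∀ i ∈ I, ∃ y ∈ X, y i = true) (hJ : ∀ j ∈ J, ∃ y ∈ X, y j = false)
    (hIJ : ∀ i ∈ I, ∀ j ∈ J, ∃ y ∈ X, y i = true ∧ y j = false) :
    ∃ y ∈ X, (∀ i ∈ I, y i = true) ∧ ∀ j ∈ J, y j = false := by
  classical
  have meets (C : (ι → Bool) → Prop)
      (hC : ∀ x y, C x → C y → C (fun i => x i && y i)) (h0 : ∃ y ∈ X, C y)
      (h : ∀ j ∈ J, ∃ y ∈ X, C y ∧ y j = false) :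
      ∃ y ∈ X, C y ∧ ∀ j ∈ J, y j = false := by
    induction J using Finset.induction_on with
    | empty => simpa using h0
    | insert a s _ ih =>
      simp only [Finset.forall_mem_insert] at h hJ hIJ ⊢
      obtain ⟨y, hy, hCy, hya⟩ := h.1
      obtain ⟨z, hz, hCz, hzs⟩ := ih hJ.2 (fun i hi => (hIJ i hi).2) h.2
      refine ⟨_, (hops y hy z hz).1, hC y z hCy hCz, by simp [hya], fun j hj => ?_⟩
      simp [hzs j hj]
  induction I using Finset.induction_on with
  | empty => simpa using meets (fun _ => True) (by simp) (by simpa [Set.Nonempty] using hne) (by simpa using hJ)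
  | insert a s _ ih =>
    simp only [Finset.forall_mem_insert] at hI hIJ ⊢
    obtain ⟨y, hy, hya, hyJ⟩ := meets (fun y => y a = true)
      (fun x y hx hy => by simp [hx, hy]) hI.1 hIJ.1
    obtain ⟨z, hz, hzs, hzJ⟩ := ih hI.2 hIJ.2
    refine ⟨_, (hops y hy z hz).2, ⟨by simp [hya], fun i hi => ?_⟩, fun j hj => ?_⟩
    · simp [hzs i hi]
    · simp [hyJ j hj, hzJ j hj]

/-- Every subshift of the binary full shift closed under the cellwise lattice
operations (`&&` is the meet and `||` the join of the lattice `𝟚 = Bool`)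
is a shift of finite type. -/
theorem stmt4 (X : Set (ℤ → Bool)) (hX : IsSubshift X)
    (hops : ∀ x ∈ X, ∀ y ∈ X, (fun i => x i && y i) ∈ X ∧ (fun i => x i || y i) ∈ X) :
    IsSFT X := by
  obtain ⟨N₁, hN₁⟩ := exists_bound_forall_of_add
    (fun d => ∀ y ∈ X, ∀ i : ℤ, y i = true → y (i + d) = true)
  obtain ⟨N₂, hN₂⟩ := exists_bound_forall_of_add
    (fun d => ∀ y ∈ X, ∀ i : ℤ, y i = true → y (i - d) = true)
  refine ⟨N₁ + N₂ + 1, by omega,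
    {w | ∃ y ∈ X, ∀ k : Fin (N₁ + N₂ + 1), w k = y (k : ℕ)}, Set.Subset.antisymm ?_ ?_⟩
  · exact fun x hx i => ⟨_, hX.translate_mem hx i, fun k => congrArg x (add_comm _ _)⟩
  intro x hx
  have window : ∀ i : ℤ, ∃ y ∈ X, ∀ k : ℕ, k ≤ N₁ + N₂ → y (i + k) = x (i + k) := by
    intro i
    obtain ⟨y, hy, hyx⟩ := hx i
    refine ⟨_, hX.translate_mem hy (-i), fun k hk => ?_⟩
    have h := hyx ⟨k, by omega⟩
    simp only at h
    rw [h]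
    congr 1
    ring
  have single : ∀ i : ℤ, ∃ y ∈ X, y i = x i := by
    intro i
    obtain ⟨y, hy, h⟩ := window i
    exact ⟨y, hy, by simpa using h 0 (Nat.zero_le _)⟩
  have pair : ∀ i j : ℤ, x i = true → x j = false → ∃ y ∈ X, y i = true ∧ y j = false := by
    intro i j hi hj
    by_contra! hcon
    have implies : ∀ y ∈ X, ∀ k : ℤ, y k = true → y (k + (j - i)) = true := by
      intro y hy k hk
      have h := hcon _ (hX.translate_mem hy (k - i)) (by simpa using hk)
      rw [show k + (j - i) = j + (k - i) by ring]
      simpa using h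
    suffices x j = true by simp [this] at hj
    rcases le_total i j with hij | hij
    · obtain ⟨d, hd⟩ := Int.eq_ofNat_of_zero_le (sub_nonneg.2 hij)
      have h := hN₁ (fun d => x (i + d) = true) (by simpa using hi) ?_ d (by rwa [← hd])
      · rw [show j = i + (d : ℤ) by omega]
        exact h
      · intro a b ha hb hbN
        obtain ⟨y, hy, hyx⟩ := window (i + a)
        have h0 := hyx 0 (by omega)
        simp only [Nat.cast_zero, add_zero] at h0
        have h := hb y hy (i + a) (h0.trans ha)
        rw [hyx b (by omega)] at h
        simpa [add_assoc] using h
    · obtain ⟨d, hd⟩ := Int.eq_ofNat_of_zero_le (sub_nonneg.2 hij)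
      have h := hN₂ (fun d => x (i - d) = true) (by simpa using hi) ?_ d ?_
      · rw [show j = i - (d : ℤ) by omega]
        exact h
      · intro a b ha hb hbN
        obtain ⟨y, hy, hyx⟩ := window (i - a - b)
        have h0 := hyx 0 (by omega)
        have h1 := hyx b (by omega)
        simp only [Nat.cast_zero, add_zero, sub_add_cancel] at h0 h1
        have h := hb y hy (i - a) (h1.trans ha)
        rw [h0] at h
        simpa [sub_sub] using h
      · intro y hy k hk
        rw [show k - (d : ℤ) = k + (j - i) by omega]
        exact implies y hy k hk
  refine hX.2.2 x fun n => ?_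
  obtain ⟨y₀, hy₀, -⟩ := single 0
  obtain ⟨y, hy, hyI, hyJ⟩ := exists_mem_eq_on_of_pairwise hops ⟨y₀, hy₀⟩
    (I := (Finset.Icc (-n : ℤ) n).filter (fun i => x i = true))
    (J := (Finset.Icc (-n : ℤ) n).filter (fun i => x i = false))
    (fun i hi => by simpa [(Finset.mem_filter.1 hi).2] using single i)
    (fun i hi => by simpa [(Finset.mem_filter.1 hi).2] using single i)
    (fun i hi j hj => pair i j (Finset.mem_filter.1 hi).2 (Finset.mem_filter.1 hj).2)
  refine ⟨y, hy, fun i hi => ?_⟩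
  have hmem : i ∈ Finset.Icc (-n : ℤ) n := Finset.mem_Icc.2 (abs_le.1 hi)
  cases h : x i
  · exact hyJ i (Finset.mem_filter.2 ⟨hmem, h⟩)
  · exact hyI i (Finset.mem_filter.2 ⟨hmem, h⟩)
end

section
/- Let S be a finite type and X ⊆ S^ℤ a lattice subshift (a subshift equipped with lattice operations ⊓, ⊔ : X × X → X that are block maps). If X is k-shallow for some k ∈ ℕ, then there exist a finite lattice S', a subshift Y ⊆ S'^ℤ closed under the cellwise operations of S', and an algebraic conjugacy φ : X → Y. -/
/-- A map `F` out of a subshift `X` has radius at most `r`. -/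
def HasRadius1 {α β : Type*} (X : Set (ℤ → α)) (F : (ℤ → α) → ℤ → β) (r : ℕ) : Prop :=
  ∀ x ∈ X, ∀ y ∈ X, ∀ i : ℤ, (∀ j : ℤ, |j - i| ≤ (r : ℤ) → x j = y j) → F x i = F y i

/-- A binary operation on subshifts has radius at most `r`. -/
def HasRadius2 {α β γ : Type*} (X : Set (ℤ → α)) (Y : Set (ℤ → β))
    (F : (ℤ → α) → (ℤ → β) → ℤ → γ) (r : ℕ) : Prop :=
  ∀ x ∈ X, ∀ x' ∈ X, ∀ y ∈ Y, ∀ y' ∈ Y, ∀ i : ℤ,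
    (∀ j : ℤ, |j - i| ≤ (r : ℤ) → x j = x' j ∧ y j = y' j) → F x y i = F x' y' i

/-- `X` is a lattice subshift with meet `m` and join `j`. -/
structure IsLatticeSubshift {S : Type*} (X : Set (ℤ → S))
    (m j : (ℤ → S) → (ℤ → S) → (ℤ → S)) : Prop where
  subshift : IsSubshift X
  meet_mem : ∀ x ∈ X, ∀ y ∈ X, m x y ∈ X
  join_mem : ∀ x ∈ X, ∀ y ∈ X, j x y ∈ X
  meet_comm : ∀ x ∈ X, ∀ y ∈ X, m x y = m y x
  join_comm : ∀ x ∈ X, ∀ y ∈ X, j x y = j y x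
  meet_assoc : ∀ x ∈ X, ∀ y ∈ X, ∀ z ∈ X, m (m x y) z = m x (m y z)
  join_assoc : ∀ x ∈ X, ∀ y ∈ X, ∀ z ∈ X, j (j x y) z = j x (j y z)
  absorb_meet : ∀ x ∈ X, ∀ y ∈ X, m x (j x y) = x
  absorb_join : ∀ x ∈ X, ∀ y ∈ X, j x (m x y) = x
  meet_radius : ∃ r : ℕ, HasRadius2 X X m r
  join_radius : ∃ r : ℕ, HasRadius2 X X j r
  meet_shift : ∀ x ∈ X, ∀ y ∈ X, shiftMap (m x y) = m (shiftMap x) (shiftMap y)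
  join_shift : ∀ x ∈ X, ∀ y ∈ X, shiftMap (j x y) = j (shiftMap x) (shiftMap y)

/-- Affine maps of the lattice subshift `(X, m, j)` together with the depth of a
defining expression: identity and constants have depth `0`, and meeting or joining
with a constant increases the depth by one. -/
inductive IsAffineDepth {S : Type*} (X : Set (ℤ → S))
    (m j : (ℤ → S) → (ℤ → S) → (ℤ → S)) : ℕ → ((ℤ → S) → (ℤ → S)) → Prop
  | id : IsAffineDepth X m j 0 (fun x => x)
  | const (c : ℤ → S) (hc : c ∈ X) : IsAffineDepth X m j 0 (fun _ => c)
  | meet (d : ℕ) (t : (ℤ → S) → (ℤ → S)) (c : ℤ → S) (hc : c ∈ X)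
      (ht : IsAffineDepth X m j d t) : IsAffineDepth X m j (d + 1) (fun x => m (t x) c)
  | join (d : ℕ) (t : (ℤ → S) → (ℤ → S)) (c : ℤ → S) (hc : c ∈ X)
      (ht : IsAffineDepth X m j d t) : IsAffineDepth X m j (d + 1) (fun x => j (t x) c)

/-- Conjugacy data to a cellwise lattice subshift `Y` over a finite lattice `S'`. -/
def ConjugacyData {S : Type*} (X : Set (ℤ → S)) (m j : (ℤ → S) → (ℤ → S) → (ℤ → S))
    {S' : Type} [Lattice S'] (Y : Set (ℤ → S')) : Prop :=
  IsSubshift Y ∧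
  (∀ y ∈ Y, ∀ z ∈ Y, (fun i => y i ⊓ z i) ∈ Y ∧ (fun i => y i ⊔ z i) ∈ Y) ∧
  ∃ (φ : (ℤ → S) → (ℤ → S')) (ψ : (ℤ → S') → (ℤ → S)),
    Set.BijOn φ X Y ∧ (∀ x ∈ X, ψ (φ x) = x) ∧
    (∃ r : ℕ, HasRadius1 X φ r) ∧ (∃ r : ℕ, HasRadius1 Y ψ r) ∧
    (∀ x ∈ X, φ (shiftMap x) = shiftMap (φ x)) ∧
    (∀ x ∈ X, ∀ y ∈ X, φ (m x y) = fun i => φ x i ⊓ φ y i) ∧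
    (∀ x ∈ X, ∀ y ∈ X, φ (j x y) = fun i => φ x i ⊔ φ y i)

/-- `(X, m, j)` is, up to algebraic conjugacy, a cellwise lattice subshift. -/
def AlgConjToCellwise {S : Type*} (X : Set (ℤ → S))
    (m j : (ℤ → S) → (ℤ → S) → (ℤ → S)) : Prop :=
  ∃ (S' : Type) (_ : Fintype S') (iL : Lattice S') (Y : Set (ℤ → S')),
    @ConjugacyData S X m j S' iL Y

/-- The shift by an arbitrary integer. -/
def shiftBy {α : Type*} (i : ℤ) (x : ℤ → α) : ℤ → α := fun n => x (n + i)

/-- Two points are affinely indistinguishable if all affine maps send them to points with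
the same symbol at the origin. -/
def AffineIndist {S : Type*} (X : Set (ℤ → S)) (m j : (ℤ → S) → (ℤ → S) → (ℤ → S))
    (x y : ℤ → S) : Prop :=
  ∀ (d : ℕ) (t : (ℤ → S) → (ℤ → S)), IsAffineDepth X m j d t → t x 0 = t y 0

theorem shiftBy_zero {α : Type*} (x : ℤ → α) : shiftBy 0 x = x := by
  funext n; simp [shiftBy]

theorem shiftMap_shiftBy {α : Type*} (i : ℤ) (x : ℤ → α) :
    shiftMap (shiftBy i x) = shiftBy (i + 1) x := by
  funext n; simp only [shiftMap, shiftBy]; congr 1; ring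

theorem shiftBy_shiftMap {α : Type*} (i : ℤ) (x : ℤ → α) :
    shiftBy i (shiftMap x) = shiftBy (i + 1) x := by
  funext n; simp only [shiftMap, shiftBy]; congr 1; ring

theorem shiftMap_injective {α : Type*} :
    Function.Injective (shiftMap : (ℤ → α) → ℤ → α) := by
  intro x y h
  funext n
  simpa [shiftMap] using congrFun h (n - 1)

theorem IsSubshift.mem_of_shiftMap_mem {α : Type*} {X : Set (ℤ → α)} (hX : IsSubshift X)
    {x : ℤ → α} (hx : shiftMap x ∈ X) : x ∈ X := by
  obtain ⟨y, hy, h⟩ := hX.2.1 _ hx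
  exact shiftMap_injective h ▸ hy

theorem IsSubshift.shiftBy_mem {α : Type*} {X : Set (ℤ → α)} (hX : IsSubshift X)
    {x : ℤ → α} (hx : x ∈ X) (i : ℤ) : shiftBy i x ∈ X := by
  induction i using Int.induction_on with
  | zero => rwa [shiftBy_zero]
  | succ i ih => rw [← shiftMap_shiftBy]; exact hX.1 _ ih
  | pred i ih =>
    apply hX.mem_of_shiftMap_mem
    rwa [shiftMap_shiftBy, sub_add_cancel]

/-- A shift-equivariant binary operation commutes with all integer shifts. -/
theorem IsSubshift.shiftBy_op {α : Type*} {X : Set (ℤ → α)} (hX : IsSubshift X)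
    {f : (ℤ → α) → (ℤ → α) → ℤ → α}
    (hf : ∀ x ∈ X, ∀ y ∈ X, shiftMap (f x y) = f (shiftMap x) (shiftMap y))
    {x y : ℤ → α} (hx : x ∈ X) (hy : y ∈ X) (i : ℤ) :
    shiftBy i (f x y) = f (shiftBy i x) (shiftBy i y) := by
  induction i using Int.induction_on with
  | zero => simp only [shiftBy_zero]
  | succ i ih =>
    rw [← shiftMap_shiftBy, ih, hf _ (hX.shiftBy_mem hx _) _ (hX.shiftBy_mem hy _),
      shiftMap_shiftBy, shiftMap_shiftBy]
  | pred i ih =>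
    apply shiftMap_injective
    rw [hf _ (hX.shiftBy_mem hx _) _ (hX.shiftBy_mem hy _)]
    simpa only [shiftMap_shiftBy, sub_add_cancel] using ih

theorem HasRadius2.mono {α β γ : Type*} {X : Set (ℤ → α)} {Y : Set (ℤ → β)}
    {F : (ℤ → α) → (ℤ → β) → ℤ → γ} {r s : ℕ} (h : HasRadius2 X Y F r) (hrs : r ≤ s) :
    HasRadius2 X Y F s := fun x hx x' hx' y hy y' hy' i hi =>
  h x hx x' hx' y hy y' hy' i fun l hl => hi l (by omega)

theorem HasRadius1.mono {α β : Type*} {X : Set (ℤ → α)}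
    {F : (ℤ → α) → ℤ → β} {r s : ℕ} (h : HasRadius1 X F r) (hrs : r ≤ s) :
    HasRadius1 X F s := fun x hx y hy i hi => h x hx y hy i fun l hl => hi l (by omega)

theorem HasRadius2.comp_const {α : Type*} {X : Set (ℤ → α)} {f : (ℤ → α) → (ℤ → α) → ℤ → α}
    {t : (ℤ → α) → ℤ → α} {r s : ℕ} (hf : HasRadius2 X X f r) (ht : HasRadius1 X t s)
    (hmem : ∀ x ∈ X, t x ∈ X) {c : ℤ → α} (hc : c ∈ X) :
    HasRadius1 X (fun x => f (t x) c) (s + r) := by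
  intro x hx y hy i hi
  refine hf _ (hmem x hx) _ (hmem y hy) _ hc _ hc i fun l hl => ⟨?_, rfl⟩
  refine ht x hx y hy l fun n hn => hi n ?_
  have := abs_sub_le n l i
  push_cast
  omega

namespace IsAffineDepth

variable {S : Type*} {X : Set (ℤ → S)} {m j : (ℤ → S) → (ℤ → S) → (ℤ → S)}

theorem apply_mem (hL : IsLatticeSubshift X m j) {d : ℕ} {t : (ℤ → S) → (ℤ → S)}
    (ht : IsAffineDepth X m j d t) {x : ℤ → S} (hx : x ∈ X) : t x ∈ X := by
  induction ht with
  | id => exact hx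
  | const c hc => exact hc
  | meet d t c hc _ ih => exact hL.meet_mem _ ih _ hc
  | join d t c hc _ ih => exact hL.join_mem _ ih _ hc

theorem hasRadius1 (hL : IsLatticeSubshift X m j) {r : ℕ} (hm : HasRadius2 X X m r)
    (hj : HasRadius2 X X j r) {d : ℕ} {t : (ℤ → S) → (ℤ → S)}
    (ht : IsAffineDepth X m j d t) : HasRadius1 X t (d * r) := by
  induction ht with
  | id => exact fun x _ y _ i h => h i (by simp)
  | const c hc => exact fun x _ y _ i _ => rfl
  | meet d t c hc ht ih =>
    rw [Nat.succ_mul]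
    exact hm.comp_const ih (fun x hx => ht.apply_mem hL hx) hc
  | join d t c hc ht ih =>
    rw [Nat.succ_mul]
    exact hj.comp_const ih (fun x hx => ht.apply_mem hL hx) hc

theorem exists_comp {d e : ℕ} {t u : (ℤ → S) → (ℤ → S)}
    (ht : IsAffineDepth X m j d t) (hu : IsAffineDepth X m j e u) :
    ∃ d', IsAffineDepth X m j d' (fun x => t (u x)) := by
  induction ht with
  | id => exact ⟨e, hu⟩
  | const c hc => exact ⟨0, .const c hc⟩
  | meet d t c hc _ ih => obtain ⟨d', h⟩ := ih; exact ⟨_, .meet d' _ c hc h⟩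
  | join d t c hc _ ih => obtain ⟨d', h⟩ := ih; exact ⟨_, .join d' _ c hc h⟩

end IsAffineDepth

namespace AffineIndist

variable {S : Type*} {X : Set (ℤ → S)} {m j : (ℤ → S) → (ℤ → S) → (ℤ → S)}

theorem equivalence (X : Set (ℤ → S)) (m j : (ℤ → S) → (ℤ → S) → (ℤ → S)) :
    Equivalence (AffineIndist X m j) :=
  ⟨fun _ _ _ _ => rfl, fun h d t ht => (h d t ht).symm,
    fun h h' d t ht => (h d t ht).trans (h' d t ht)⟩

theorem apply_zero {x y : ℤ → S} (h : AffineIndist X m j x y) : x 0 = y 0 := h 0 _ .id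

theorem map {x y : ℤ → S} (h : AffineIndist X m j x y) {e : ℕ} {u : (ℤ → S) → (ℤ → S)}
    (hu : IsAffineDepth X m j e u) : AffineIndist X m j (u x) (u y) := fun _ _ ht =>
  let ⟨_, h'⟩ := ht.exists_comp hu
  h _ _ h'

theorem meet (hL : IsLatticeSubshift X m j) {x x' y y' : ℤ → S} (hx' : x' ∈ X)
    (hy : y ∈ X) (hy' : y' ∈ X) (h : AffineIndist X m j x x') (h' : AffineIndist X m j y y') :
    AffineIndist X m j (m x y) (m x' y') := by
  have h₂ := h'.map (.meet 0 _ x' hx' .id)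
  rw [hL.meet_comm y hy x' hx', hL.meet_comm y' hy' x' hx'] at h₂
  exact (equivalence X m j).trans (h.map (.meet 0 _ y hy .id)) h₂

theorem join (hL : IsLatticeSubshift X m j) {x x' y y' : ℤ → S} (hx' : x' ∈ X)
    (hy : y ∈ X) (hy' : y' ∈ X) (h : AffineIndist X m j x x') (h' : AffineIndist X m j y y') :
    AffineIndist X m j (j x y) (j x' y') := by
  have h₂ := h'.map (.join 0 _ x' hx' .id)
  rw [hL.join_comm y hy x' hx', hL.join_comm y' hy' x' hx'] at h₂
  exact (equivalence X m j).trans (h.map (.join 0 _ y hy .id)) h₂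

end AffineIndist

/-- An equivalence relation on a nonempty set of configurations that only depends on a finite
window has finitely many classes, so it is the kernel of a map to a finite type. -/
theorem exists_finite_classifier {S : Type*} [Finite S] {X : Set (ℤ → S)} (hX : X.Nonempty)
    {E : (ℤ → S) → (ℤ → S) → Prop} (hE : Equivalence E) (R : ℕ)
    (hR : ∀ x ∈ X, ∀ y ∈ X, (∀ i : ℤ, |i| ≤ (R : ℤ) → x i = y i) → E x y) :
    ∃ (T : Type) (_ : Fintype T) (q : (ℤ → S) → T), (∀ a, ∃ x ∈ X, q x = a) ∧
      ∀ x ∈ X, ∀ y ∈ X, q x = q y ↔ E x y := by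
  classical
  let s : Setoid X := ⟨fun x y => E x y, fun x => hE.refl x, hE.symm, hE.trans⟩
  have : Finite (Quotient s) := by
    let f : Quotient s → (Set.Icc (-(R : ℤ)) R → S) := fun c i => c.out.1 i
    refine Finite.of_injective f fun a b hab => ?_
    rw [← a.out_eq, ← b.out_eq]
    exact Quotient.sound (hR _ a.out.2 _ b.out.2 fun i hi => congrFun hab ⟨i, abs_le.1 hi⟩)
  obtain ⟨n, ⟨e⟩⟩ := Finite.exists_equiv_fin (Quotient s)
  obtain ⟨x₀, hx₀⟩ := hX
  have hq : ∀ x (hx : x ∈ X),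
      (if h : x ∈ X then e ⟦⟨x, h⟩⟧ else e ⟦⟨x₀, hx₀⟩⟧) = e ⟦⟨x, hx⟩⟧ := fun x hx => dif_pos hx
  refine ⟨Fin n, inferInstance,
    fun x => if h : x ∈ X then e ⟦⟨x, h⟩⟧ else e ⟦⟨x₀, hx₀⟩⟧, fun a => ?_, fun x hx y hy => ?_⟩
  · refine ⟨(e.symm a).out.1, (e.symm a).out.2, ?_⟩
    exact (hq _ (e.symm a).out.2).trans (e.eq_symm_apply.1 (e.symm a).out_eq)
  · dsimp only
    rw [hq x hx, hq y hy, e.apply_eq_iff_eq]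
    exact Quotient.eq

theorem algConjToCellwise_empty {S : Type*} [Finite S]
    (m j : (ℤ → S) → (ℤ → S) → (ℤ → S)) : AlgConjToCellwise (∅ : Set (ℤ → S)) m j := by
  obtain ⟨n, ⟨e⟩⟩ := Finite.exists_equiv_fin S
  refine ⟨Fin n, inferInstance, inferInstance, ∅, ⟨by simp, by simp, ?_⟩, by simp,
    fun x i => e (x i), fun y i => e.symm (y i), Set.bijOn_empty _, by simp, ⟨0, ?_⟩, ⟨0, ?_⟩,
    by simp, by simp, by simp⟩
  · intro x h
    obtain ⟨y, hy, _⟩ := h 0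
    exact hy.elim
  · exact fun x hx => hx.elim
  · exact fun x hx => hx.elim

/-- If affine indistinguishability has a finite-type classifier, then the classifying alphabet
inherits a lattice structure for which the classifier is a homomorphism. -/
theorem exists_lattice_of_classifier {S : Type*} {X : Set (ℤ → S)}
    {m j : (ℤ → S) → (ℤ → S) → (ℤ → S)} (hL : IsLatticeSubshift X m j) {T : Type}
    {q : (ℤ → S) → T} (hsurj : ∀ a, ∃ x ∈ X, q x = a)
    (hq : ∀ x ∈ X, ∀ y ∈ X, q x = q y ↔ AffineIndist X m j x y) :
    ∃ _ : Lattice T, (∀ x ∈ X, ∀ y ∈ X, q (m x y) = q x ⊓ q y) ∧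
      ∀ x ∈ X, ∀ y ∈ X, q (j x y) = q x ⊔ q y := by
  choose s hsX hs using hsurj
  let iMin : Min T := ⟨fun a b => q (m (s a) (s b))⟩
  let iMax : Max T := ⟨fun a b => q (j (s a) (s b))⟩
  have hs' : ∀ x ∈ X, AffineIndist X m j x (s (q x)) := fun x hx =>
    (hq x hx _ (hsX _)).1 (hs _).symm
  have hm : ∀ x ∈ X, ∀ y ∈ X, q (m x y) = q x ⊓ q y := fun x hx y hy =>
    (hq _ (hL.meet_mem x hx y hy) _ (hL.meet_mem _ (hsX _) _ (hsX _))).2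
      (.meet hL (hsX _) hy (hsX _) (hs' x hx) (hs' y hy))
  have hj : ∀ x ∈ X, ∀ y ∈ X, q (j x y) = q x ⊔ q y := fun x hx y hy =>
    (hq _ (hL.join_mem x hx y hy) _ (hL.join_mem _ (hsX _) _ (hsX _))).2
      (.join hL (hsX _) hy (hsX _) (hs' x hx) (hs' y hy))
  have key : ∀ a, ∃ x ∈ X, q x = a := fun a => ⟨s a, hsX a, hs a⟩
  refine ⟨Lattice.mk' ?_ ?_ ?_ ?_ ?_ ?_, hm, hj⟩
  · intro a b
    obtain ⟨x, hx, rfl⟩ := key a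
    obtain ⟨y, hy, rfl⟩ := key b
    rw [← hj x hx y hy, ← hj y hy x hx, hL.join_comm x hx y hy]
  · intro a b c
    obtain ⟨x, hx, rfl⟩ := key a
    obtain ⟨y, hy, rfl⟩ := key b
    obtain ⟨z, hz, rfl⟩ := key c
    rw [← hj x hx y hy, ← hj _ (hL.join_mem x hx y hy) z hz, ← hj y hy z hz,
      ← hj x hx _ (hL.join_mem y hy z hz), hL.join_assoc x hx y hy z hz]
  · intro a b
    obtain ⟨x, hx, rfl⟩ := key a
    obtain ⟨y, hy, rfl⟩ := key b
    rw [← hm x hx y hy, ← hm y hy x hx, hL.meet_comm x hx y hy]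
  · intro a b c
    obtain ⟨x, hx, rfl⟩ := key a
    obtain ⟨y, hy, rfl⟩ := key b
    obtain ⟨z, hz, rfl⟩ := key c
    rw [← hm x hx y hy, ← hm _ (hL.meet_mem x hx y hy) z hz, ← hm y hy z hz,
      ← hm x hx _ (hL.meet_mem y hy z hz), hL.meet_assoc x hx y hy z hz]
  · intro a b
    obtain ⟨x, hx, rfl⟩ := key a
    obtain ⟨y, hy, rfl⟩ := key b
    rw [← hm x hx y hy, ← hj x hx _ (hL.meet_mem x hx y hy), hL.absorb_join x hx y hy]
  · intro a b
    obtain ⟨x, hx, rfl⟩ := key a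
    obtain ⟨y, hy, rfl⟩ := key b
    rw [← hj x hx y hy, ← hm x hx _ (hL.join_mem x hx y hy), hL.absorb_meet x hx y hy]

/-- A block map `x ↦ (i ↦ q (σⁱ x))` whose local rule is a lattice homomorphism determining the
symbol at the origin is an algebraic conjugacy onto a cellwise lattice subshift. -/
theorem IsLatticeSubshift.conjugacyData_image {S : Type*} {X : Set (ℤ → S)}
    {m j : (ℤ → S) → (ℤ → S) → (ℤ → S)} (hL : IsLatticeSubshift X m j) {T : Type} [Lattice T]
    {q : (ℤ → S) → T} {p : T → S} (hp : ∀ x ∈ X, p (q x) = x 0) {R : ℕ}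
    (hR : ∀ x ∈ X, ∀ y ∈ X, (∀ i : ℤ, |i| ≤ (R : ℤ) → x i = y i) → q x = q y)
    (hm : ∀ x ∈ X, ∀ y ∈ X, q (m x y) = q x ⊓ q y)
    (hj : ∀ x ∈ X, ∀ y ∈ X, q (j x y) = q x ⊔ q y) :
    ConjugacyData X m j ((fun x i => q (shiftBy i x)) '' X) := by
  have hX := hL.subshift
  have hpφ : ∀ x ∈ X, ∀ i, p (q (shiftBy i x)) = x i := fun x hx i => by
    rw [hp _ (hX.shiftBy_mem hx i)]; simp [shiftBy]
  have hσ : ∀ x : ℤ → S, (fun i => q (shiftBy i (shiftMap x))) =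
      shiftMap (fun i => q (shiftBy i x)) := fun x => by
    funext i; rw [shiftBy_shiftMap]; rfl
  have hφ : HasRadius1 X (fun x i => q (shiftBy i x)) R := fun x hx y hy i h =>
    hR _ (hX.shiftBy_mem hx i) _ (hX.shiftBy_mem hy i) fun n hn => h _ (by simpa using hn)
  have hφm : ∀ x ∈ X, ∀ y ∈ X, (fun i => q (shiftBy i (m x y))) =
      fun i => q (shiftBy i x) ⊓ q (shiftBy i y) := fun x hx y hy => by
    funext i
    rw [hX.shiftBy_op hL.meet_shift hx hy, hm _ (hX.shiftBy_mem hx i) _ (hX.shiftBy_mem hy i)]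
  have hφj : ∀ x ∈ X, ∀ y ∈ X, (fun i => q (shiftBy i (j x y))) =
      fun i => q (shiftBy i x) ⊔ q (shiftBy i y) := fun x hx y hy => by
    funext i
    rw [hX.shiftBy_op hL.join_shift hx hy, hj _ (hX.shiftBy_mem hx i) _ (hX.shiftBy_mem hy i)]
  refine ⟨⟨?_, ?_, ?_⟩, ?_, fun x i => q (shiftBy i x), fun y i => p (y i), ?_, ?_, ⟨R, hφ⟩,
    ⟨0, ?_⟩, fun x _ => hσ x, hφm, hφj⟩
  · rintro _ ⟨x, hx, rfl⟩
    exact ⟨shiftMap x, hX.1 x hx, hσ x⟩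
  · rintro _ ⟨x, hx, rfl⟩
    obtain ⟨y, hy, rfl⟩ := hX.2.1 x hx
    exact ⟨_, ⟨y, hy, rfl⟩, (hσ y).symm⟩
  · intro y hy
    have hmem : (fun i => p (y i)) ∈ X := by
      refine hX.2.2 _ fun n => ?_
      obtain ⟨_, ⟨x, hx, rfl⟩, h⟩ := hy n
      exact ⟨x, hx, fun i hi => by rw [← h i hi, hpφ x hx]⟩
    refine ⟨_, hmem, funext fun i => ?_⟩
    obtain ⟨_, ⟨x, hx, rfl⟩, h⟩ := hy (i.natAbs + R)
    rw [← h i (by push_cast; omega)]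
    refine hφ _ hmem x hx i fun l hl => ?_
    have := abs_add_le i (l - i)
    rw [add_sub_cancel] at this
    rw [← h l (by push_cast; omega), hpφ x hx]
  · rintro _ ⟨x, hx, rfl⟩ _ ⟨y, hy, rfl⟩
    exact ⟨⟨_, hL.meet_mem x hx y hy, hφm x hx y hy⟩, ⟨_, hL.join_mem x hx y hy, hφj x hx y hy⟩⟩
  · refine Set.InjOn.bijOn_image fun x hx y hy h => funext fun i => ?_
    rw [← hpφ x hx i, ← hpφ y hy i]
    exact congrArg p (congrFun h i)
  · exact fun x hx => funext (hpφ x hx)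
  · exact fun x _ y _ i h => congrArg p (h i (by simp))

/-- Theorem: a `k`-shallow lattice subshift is cellwise up to algebraic conjugacy.
`k`-shallowness: every affine map agrees on `X` with an affine map of depth at most `k`. -/
theorem stmt8 {S : Type*} [Fintype S]
    (X : Set (ℤ → S)) (m j : (ℤ → S) → (ℤ → S) → (ℤ → S))
    (hL : IsLatticeSubshift X m j) (k : ℕ)
    (hshallow : ∀ (d : ℕ) (t : (ℤ → S) → (ℤ → S)), IsAffineDepth X m j d t →
      ∃ d' ≤ k, ∃ t' : (ℤ → S) → (ℤ → S), IsAffineDepth X m j d' t' ∧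
        ∀ x ∈ X, t x = t' x) :
    AlgConjToCellwise X m j := by
  obtain rfl | hne := X.eq_empty_or_nonempty
  · exact algConjToCellwise_empty m j
  obtain ⟨r₁, hr₁⟩ := hL.meet_radius
  obtain ⟨r₂, hr₂⟩ := hL.join_radius
  have hwindow : ∀ x ∈ X, ∀ y ∈ X,
      (∀ i : ℤ, |i| ≤ ((k * max r₁ r₂ : ℕ) : ℤ) → x i = y i) → AffineIndist X m j x y := by
    intro x hx y hy hxy d t ht
    obtain ⟨d', hd', t', ht', htt'⟩ := hshallow d t ht
    rw [htt' x hx, htt' y hy]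
    exact ((ht'.hasRadius1 hL (hr₁.mono (le_max_left _ _)) (hr₂.mono (le_max_right _ _))).mono
      (Nat.mul_le_mul_right _ hd')) x hx y hy 0 fun i hi => hxy i (by simpa using hi)
  obtain ⟨T, iT, q, hsurj, hq⟩ :=
    exists_finite_classifier hne (AffineIndist.equivalence X m j) _ hwindow
  obtain ⟨iL, hm, hj⟩ := exists_lattice_of_classifier hL hsurj hq
  choose s hsX hs using hsurj
  exact ⟨T, iT, iL, _, hL.conjugacyData_image (p := fun a => s a 0)
    (fun x hx => ((hq _ (hsX _) x hx).1 (hs _)).apply_zero)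
    (fun x hx y hy h => (hq x hx y hy).2 (hwindow x hx y hy h)) hm hj⟩
end
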